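/- arXiv:2204.04848 — 4 statements merged into one kernel-verified Lean document; each statement's English description precedes it below -/
import Mathlib

section
/- (Lower-bounding lemma) For every repair sequence σ, let (g_1,…,g_n) be the non-decreasing rearrangement of the leg lengths (d(j_0,j_1), d(j_1,j_2), …, d(j_{n−1},j_n)). Then the total service disruption time satisfies T(σ) ≥ ∑_{p=1}^{n} c_p(σ) · g_p. -/
/-- `W n pre S` is the number of vertices of `V_c = {1,…,n}` without power service
when exactly the vertices in `S` have been repaired: vertices `j` having some
predecessor-or-self `i` (i.e. `pre i j`) that is not in `S`. -/
noncomputable def W (n : ℕ) (pre : ℕ → ℕ → Prop) (S : Finset ℕ) : ℕ :=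
  {j | j ∈ Finset.Icc 1 n ∧ ∃ i ∈ Finset.Icc 1 n, pre i j ∧ i ∉ S}.ncard

/-- `jseq σ p` is the `p`-th visited vertex: the depot `0` for `p = 0`, and `σ p` otherwise. -/
def jseq (σ : ℕ → ℕ) (p : ℕ) : ℕ := if p = 0 then 0 else σ p

/-- Arrival time at the `p`-th visited vertex: `t_p = ∑_{q=1}^p d(j_{q-1}, j_q)`. -/
def arrival (d : ℕ → ℕ → ℝ) (σ : ℕ → ℕ) (p : ℕ) : ℝ :=
  ∑ q ∈ Finset.Icc 1 p, d (jseq σ (q - 1)) (jseq σ q)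

/-- `lastPos n pre σ i = max { p ∈ [1,n] : σ p ⪰ i }`, the position at which the
service of vertex `i` is restored. -/
noncomputable def lastPos (n : ℕ) (pre : ℕ → ℕ → Prop) (σ : ℕ → ℕ) (i : ℕ) : ℕ :=
  sSup {p : ℕ | p ∈ Finset.Icc 1 n ∧ pre (σ p) i}

/-- Total service disruption time `T(σ) = ∑_{i ∈ V_c} r_i` where `r_i = t_{p(i)}`. -/
noncomputable def totalT (n : ℕ) (d : ℕ → ℕ → ℝ) (pre : ℕ → ℕ → Prop) (σ : ℕ → ℕ) : ℝ :=
  ∑ i ∈ Finset.Icc 1 n, arrival d σ (lastPos n pre σ i)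

/-- `cNum n pre σ p = c_p(σ) = W({σ(1),…,σ(p−1)})`, the number of vertices without
power right before the `p`-th repair. -/
noncomputable def cNum (n : ℕ) (pre : ℕ → ℕ → Prop) (σ : ℕ → ℕ) (p : ℕ) : ℕ :=
  W n pre ((Finset.Icc 1 (p - 1)).image σ)

/-- The multiset of leg lengths `d(j_{p-1}, j_p)`, `p = 1,…,n`, of the route `σ`. -/
def legs (n : ℕ) (d : ℕ → ℕ → ℝ) (σ : ℕ → ℕ) : Multiset ℝ :=
  (Finset.Icc 1 n).val.map fun p => d (jseq σ (p - 1)) (jseq σ p)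

/-- `gLeg n d σ p` is the `p`-th entry of the non-decreasing rearrangement of the leg lengths. -/
noncomputable def gLeg (n : ℕ) (d : ℕ → ℕ → ℝ) (σ : ℕ → ℕ) (p : ℕ) : ℝ :=
  ((legs n d σ).sort (· ≤ ·)).getD (p - 1) 0

/-- Among all sublists of a given length, the initial segment of a sorted list has the
smallest sum. -/
theorem List.Pairwise.sum_take_length_le_sum_of_sublist {α : Type*} [AddCommMonoid α]
    [PartialOrder α] [IsOrderedAddMonoid α] {l : List α} (hl : l.Pairwise (· ≤ ·))
    {s : List α} (hs : s.Sublist l) : (l.take s.length).sum ≤ s.sum := by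
  induction l generalizing s with
  | nil => simp_all
  | cons a l ih =>
    rw [List.pairwise_cons] at hl
    cases s with
    | nil => simp
    | cons b t =>
      have htl : t.Sublist l := hs.tail
      have hab : a ≤ b := by
        rcases List.mem_cons.1 (hs.subset List.mem_cons_self) with h | h
        · exact h.ge
        · exact hl.1 b h
      simpa using add_le_add hab (ih hl.2 htl)

theorem List.sum_range_getD_zero {α : Type*} [AddCommMonoid α] (l : List α) (m : ℕ) :
    ∑ i ∈ Finset.range m, l.getD i 0 = (l.take m).sum := by
  induction m with
  | zero => simp
  | succ m ih =>
    rw [Finset.sum_range_succ, ih, List.take_add_one, List.sum_append]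
    cases h : l[m]? <;> simp [List.getD, h]

theorem gLeg_nonneg (n : ℕ) (d : ℕ → ℕ → ℝ) (hd : ∀ i j, 0 ≤ d i j) (σ : ℕ → ℕ) (p : ℕ) :
    0 ≤ gLeg n d σ p := by
  unfold gLeg
  by_cases h : p - 1 < ((legs n d σ).sort (· ≤ ·)).length
  · rw [List.getD_eq_getElem _ _ h]
    obtain ⟨q, -, hq⟩ := Multiset.mem_map.1 ((Multiset.mem_sort _).1 (List.getElem_mem h))
    exact hq ▸ hd _ _
  · rw [List.getD_eq_default _ _ (not_lt.1 h)]

theorem sum_gLeg_le_arrival {n m : ℕ} (hm : m ≤ n) (d : ℕ → ℕ → ℝ) (σ : ℕ → ℕ) :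
    ∑ p ∈ Finset.Icc 1 m, gLeg n d σ p ≤ arrival d σ m := by
  have hle : legs m d σ ≤ legs n d σ :=
    Multiset.map_le_map (Finset.val_le_iff.2 (Finset.Icc_subset_Icc_right hm))
  have hcard : (legs m d σ).card = m := by simp [legs]
  obtain ⟨s, hs, hsub⟩ : (legs m d σ).toList.Subperm ((legs n d σ).sort (· ≤ ·)) := by
    rw [← Multiset.coe_le, Multiset.coe_toList, Multiset.sort_eq]
    exact hle
  have hlen : s.length = m := by
    rw [hs.length_eq, Multiset.length_toList, hcard]
  have hsum : s.sum = arrival d σ m := by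
    rw [hs.sum_eq, Multiset.sum_toList]
    rfl
  have key := List.Pairwise.sum_take_length_le_sum_of_sublist
    (Multiset.pairwise_sort (legs n d σ) (· ≤ ·)) hsub
  rw [hlen, hsum, ← List.sum_range_getD_zero] at key
  refine le_of_eq_of_le ?_ key
  rw [Finset.range_eq_Ico, Finset.sum_Ico_eq_sum_range, ← Finset.Ico_add_one_right_eq_Icc,
    Finset.sum_Ico_eq_sum_range]
  simp [gLeg]

theorem lastPos_le (n : ℕ) (pre : ℕ → ℕ → Prop) (σ : ℕ → ℕ) (i : ℕ) : lastPos n pre σ i ≤ n :=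
  csSup_le' fun _ hp => (Finset.mem_Icc.1 hp.1).2

theorem cNum_le_card_lastPos {n : ℕ} (pre : ℕ → ℕ → Prop) {σ : ℕ → ℕ}
    (hσ : Set.SurjOn σ (Set.Icc 1 n) (Set.Icc 1 n)) (p : ℕ) :
    cNum n pre σ p ≤ ((Finset.Icc 1 n).filter fun i => p ≤ lastPos n pre σ i).card := by
  rw [← Set.ncard_coe_finset]
  refine Set.ncard_le_ncard ?_ (Finset.finite_toSet _)
  rintro j ⟨hj, i, hi, hij, hiS⟩
  obtain ⟨q, hq, rfl⟩ := hσ (Finset.mem_Icc.1 hi)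
  have hpq : p ≤ q := by
    by_contra! h
    exact hiS (Finset.mem_image_of_mem σ (Finset.mem_Icc.2 ⟨hq.1, by omega⟩))
  refine Finset.mem_coe.2 (Finset.mem_filter.2 ⟨hj, hpq.trans (le_csSup ?_ ?_)⟩)
  · exact ⟨n, fun _ hr => (Finset.mem_Icc.1 hr.1).2⟩
  · exact ⟨Finset.mem_Icc.2 hq, hij⟩

/-- **Lower-bounding lemma.** For every repair sequence `σ`, if
`(g_1,…,g_n)` is the non-decreasing rearrangement of the leg lengths, then
`T(σ) ≥ ∑_{p=1}^{n} c_p(σ) · g_p`. -/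
theorem stmt2
    (n : ℕ) (hn : 1 ≤ n)
    (d : ℕ → ℕ → ℝ) (hd : ∀ i j, 0 ≤ d i j)
    (pre : ℕ → ℕ → Prop)
    (hrefl : ∀ i ∈ Finset.Icc 1 n, pre i i)
    (htrans : ∀ i j k, pre i j → pre j k → pre i k)
    (hantisymm : ∀ i j, pre i j → pre j i → i = j)
    (σ : ℕ → ℕ) (hσ : Set.BijOn σ (Set.Icc 1 n) (Set.Icc 1 n))
    :
    ∑ p ∈ Finset.Icc 1 n, (cNum n pre σ p : ℝ) * gLeg n d σ p ≤ totalT n d pre σ := by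
  calc
    ∑ p ∈ Finset.Icc 1 n, (cNum n pre σ p : ℝ) * gLeg n d σ p
      ≤ ∑ p ∈ Finset.Icc 1 n,
          (((Finset.Icc 1 n).filter fun i => p ≤ lastPos n pre σ i).card : ℝ) * gLeg n d σ p :=
        Finset.sum_le_sum fun p _ => mul_le_mul_of_nonneg_right
          (Nat.cast_le.2 (cNum_le_card_lastPos pre hσ.surjOn p)) (gLeg_nonneg n d hd σ p)
    _ = ∑ p ∈ Finset.Icc 1 n, ∑ i ∈ (Finset.Icc 1 n).filter (fun i => p ≤ lastPos n pre σ i),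
          gLeg n d σ p := by
        simp
    _ = ∑ i ∈ Finset.Icc 1 n, ∑ p ∈ Finset.Icc 1 (lastPos n pre σ i), gLeg n d σ p := by
        refine Finset.sum_comm' fun p i => ?_
        have := lastPos_le n pre σ i
        simp only [Finset.mem_filter, Finset.mem_Icc]
        omega
    _ ≤ totalT n d pre σ :=
        Finset.sum_le_sum fun i _ => sum_gLeg_le_arrival (lastPos_le n pre σ i) d σ
end

section
/- (Return-path dominance) Let P_1 and P_2 be return paths with k vertices each (1 ≤ k ≤ n) that have the same configuration, i.e., they start at the same vertex and visit the same set of vertices. If v^B(P_1) < v^B(P_2), then no optimal repair sequence ends with P_2: for every repair sequence σ that ends with P_2, the repair sequence σ' obtained from σ by replacing its last k entries with P_1 satisfies T(σ') < T(σ). -/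
/-- `vB n d pre k P = v^B(P) = ∑_{q=2}^{k} W(V_c ∖ {i_q,…,i_k}) · d(i_{q−1}, i_q)` for a
return path `P = (i_1,…,i_k)`. -/
noncomputable def vB (n : ℕ) (d : ℕ → ℕ → ℝ) (pre : ℕ → ℕ → Prop) (k : ℕ) (P : ℕ → ℕ) : ℝ :=
  ∑ q ∈ Finset.Icc 2 k, (W n pre (Finset.Icc 1 n \ (Finset.Icc q k).image P) : ℝ) * d (P (q - 1)) (P q)

open Finset in
theorem le_lastPos_iff (n : ℕ) (pre : ℕ → ℕ → Prop) (σ : ℕ → ℕ) (i : ℕ) {q : ℕ} (hq : 1 ≤ q) :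
    q ≤ lastPos n pre σ i ↔ ∃ p ∈ Icc q n, pre (σ p) i := by
  have hbdd : BddAbove {p : ℕ | p ∈ Icc 1 n ∧ pre (σ p) i} :=
    ⟨n, fun p hp => (mem_Icc.1 hp.1).2⟩
  constructor
  · intro h
    have hne : {p : ℕ | p ∈ Icc 1 n ∧ pre (σ p) i}.Nonempty := by
      by_contra hemp
      rw [Set.not_nonempty_iff_eq_empty] at hemp
      have h0 : lastPos n pre σ i = 0 := by
        rw [lastPos, hemp]
        exact csSup_empty
      omega
    have hmem := Nat.sSup_mem hne hbdd
    exact ⟨lastPos n pre σ i, mem_Icc.2 ⟨h, (mem_Icc.1 hmem.1).2⟩, hmem.2⟩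
  · rintro ⟨p, hp, hpi⟩
    rw [mem_Icc] at hp
    exact hp.1.trans (le_csSup hbdd ⟨mem_Icc.2 ⟨hq.trans hp.1, hp.2⟩, hpi⟩)

open Finset in
/-- The vertices still without service before the `q`-th repair are those whose service is
restored at position `q` or later. -/
theorem W_sdiff_image_eq_card (n : ℕ) (pre : ℕ → ℕ → Prop) (σ : ℕ → ℕ)
    (hσ : ∀ p ∈ Icc 1 n, σ p ∈ Icc 1 n) {q : ℕ} (hq : 1 ≤ q) :
    W n pre (Icc 1 n \ (Icc q n).image σ) = #{i ∈ Icc 1 n | q ≤ lastPos n pre σ i} := by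
  rw [W, ← Set.ncard_coe_finset]
  congr 1
  ext j
  simp only [Set.mem_ofPred_eq, coe_filter, le_lastPos_iff n pre σ j hq]
  refine and_congr_right fun _ => ⟨?_, ?_⟩
  · rintro ⟨i, hi, hij, hiS⟩
    simp only [mem_sdiff, hi, true_and, not_not, mem_image] at hiS
    obtain ⟨p, hp, rfl⟩ := hiS
    exact ⟨p, hp, hij⟩
  · rintro ⟨p, hp, hpj⟩
    refine ⟨σ p, hσ p (Icc_subset_Icc_left hq hp), hpj, fun h => ?_⟩
    exact (mem_sdiff.1 h).2 (mem_image_of_mem σ hp)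

open Finset in
/-- The total disruption time, grouped by travelled edges. -/
theorem totalT_eq_sum_W (n : ℕ) (d : ℕ → ℕ → ℝ) (pre : ℕ → ℕ → Prop) (σ : ℕ → ℕ)
    (hσ : ∀ p ∈ Icc 1 n, σ p ∈ Icc 1 n) :
    totalT n d pre σ = ∑ q ∈ Icc 1 n,
      (W n pre (Icc 1 n \ (Icc q n).image σ) : ℝ) * d (jseq σ (q - 1)) (jseq σ q) := by
  have harr : ∀ i, arrival d σ (lastPos n pre σ i) = ∑ q ∈ Icc 1 n,
      if q ≤ lastPos n pre σ i then d (jseq σ (q - 1)) (jseq σ q) else 0 := by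
    intro i
    rw [arrival, ← sum_filter]
    refine sum_congr ?_ fun _ _ => rfl
    ext q
    have := lastPos_le n pre σ i
    simp only [mem_filter, mem_Icc]
    omega
  simp only [totalT, harr]
  rw [sum_comm]
  refine sum_congr rfl fun q hq => ?_
  rw [W_sdiff_image_eq_card n pre σ hσ (mem_Icc.1 hq).1, ← sum_filter, sum_const, nsmul_eq_mul]

open Finset in
theorem image_Icc_shift {m k q : ℕ} {σ P : ℕ → ℕ} (hend : ∀ r ∈ Icc 1 k, σ (m + r) = P r)
    (hq : 1 ≤ q) : (Icc (m + q) (m + k)).image σ = (Icc q k).image P := by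
  rw [← image_add_left_Icc, image_image]
  exact image_congr fun r hr => hend r (Icc_subset_Icc_left hq (mem_coe.1 hr))

open Finset in
/-- The total disruption time of a sequence that ends with the return path `P` splits into the
contribution of the edges up to the first vertex of `P` and `v^B(P)`. -/
theorem totalT_eq_add_vB (m k : ℕ) (hk : 1 ≤ k) (d : ℕ → ℕ → ℝ) (pre : ℕ → ℕ → Prop)
    (σ P : ℕ → ℕ) (hσ : ∀ p ∈ Icc 1 (m + k), σ p ∈ Icc 1 (m + k))
    (hend : ∀ q ∈ Icc 1 k, σ (m + q) = P q) :
    totalT (m + k) d pre σ = ∑ q ∈ Icc 1 (m + 1),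
      (W (m + k) pre (Icc 1 (m + k) \ ((Icc q m).image σ ∪ (Icc 1 k).image P)) : ℝ)
        * d (jseq σ (q - 1)) (jseq σ q) + vB (m + k) d pre k P := by
  have hsplit : Icc 1 (m + k) = Icc 1 (m + 1) ∪ Icc (m + 2) (m + k) := by
    ext q
    simp only [mem_union, mem_Icc]
    omega
  have hdisj : Disjoint (Icc 1 (m + 1)) (Icc (m + 2) (m + k)) := by
    rw [disjoint_left]
    intro q
    simp only [mem_Icc]
    omega
  have hsum := totalT_eq_sum_W (m + k) d pre σ hσ
  rw [sum_congr hsplit fun _ _ => rfl, sum_union hdisj] at hsum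
  rw [hsum]
  congr 1
  · refine sum_congr rfl fun q hq => ?_
    have hIcc : Icc q (m + k) = Icc q m ∪ Icc (m + 1) (m + k) := by
      rw [mem_Icc] at hq
      ext r
      simp only [mem_union, mem_Icc]
      omega
    rw [hIcc, image_union, image_Icc_shift hend le_rfl]
  · rw [vB, ← image_add_left_Icc, sum_image (by simp)]
    refine sum_congr rfl fun q hq => ?_
    rw [mem_Icc] at hq
    have hpred : m + q - 1 = m + (q - 1) := by omega
    rw [image_Icc_shift hend (by omega), hpred, jseq, jseq, if_neg (by omega), if_neg (by omega),
      hend q (mem_Icc.2 (by omega)), hend (q - 1) (mem_Icc.2 (by omega))]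

/-- **Return-path dominance.** If return paths `P_1, P_2` with `k` vertices
have the same configuration and `v^B(P_1) < v^B(P_2)`, then for every repair sequence `σ`
ending with `P_2`, the repair sequence `σ'` obtained from `σ` by replacing its last `k`
entries with `P_1` satisfies `T(σ') < T(σ)`. -/
theorem stmt9
    (n : ℕ) (hn : 1 ≤ n)
    (d : ℕ → ℕ → ℝ) (hd : ∀ i j, 0 ≤ d i j)
    (pre : ℕ → ℕ → Prop)
    (hrefl : ∀ i ∈ Finset.Icc 1 n, pre i i)
    (htrans : ∀ i j k, pre i j → pre j k → pre i k)
    (hantisymm : ∀ i j, pre i j → pre j i → i = j)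
    (k : ℕ) (hk1 : 1 ≤ k) (hk2 : k ≤ n)
    (P₁ P₂ : ℕ → ℕ)
    (hP₁inj : Set.InjOn P₁ (Set.Icc 1 k)) (hP₁mem : ∀ q ∈ Finset.Icc 1 k, P₁ q ∈ Finset.Icc 1 n)
    (hP₂inj : Set.InjOn P₂ (Set.Icc 1 k)) (hP₂mem : ∀ q ∈ Finset.Icc 1 k, P₂ q ∈ Finset.Icc 1 n)
    (hstart : P₁ 1 = P₂ 1)
    (hconfig : (Finset.Icc 1 k).image P₁ = (Finset.Icc 1 k).image P₂)
    (hv : vB n d pre k P₁ < vB n d pre k P₂)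
    (σ : ℕ → ℕ) (hσ : Set.BijOn σ (Set.Icc 1 n) (Set.Icc 1 n))
    (hend : ∀ q ∈ Finset.Icc 1 k, σ (n - k + q) = P₂ q)
    (σ' : ℕ → ℕ)
    (hσ'end : ∀ q ∈ Finset.Icc 1 k, σ' (n - k + q) = P₁ q)
    (hσ'rest : ∀ p ∈ Finset.Icc 1 (n - k), σ' p = σ p) :
    totalT n d pre σ' < totalT n d pre σ := by
  obtain ⟨m, rfl⟩ : ∃ m, n = m + k := ⟨n - k, by omega⟩
  rw [Nat.add_sub_cancel] at hend hσ'end hσ'rest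
  have hmem : ∀ p ∈ Finset.Icc 1 (m + k), σ p ∈ Finset.Icc 1 (m + k) := fun p hp =>
    Finset.mem_Icc.2 (hσ.mapsTo (Finset.mem_Icc.1 hp))
  have hmem' : ∀ p ∈ Finset.Icc 1 (m + k), σ' p ∈ Finset.Icc 1 (m + k) := by
    intro p hp
    rcases le_or_gt p m with h | h
    · rw [hσ'rest p (Finset.mem_Icc.2 ⟨(Finset.mem_Icc.1 hp).1, h⟩)]
      exact hmem p hp
    · obtain ⟨r, rfl⟩ := Nat.exists_eq_add_of_le h.le
      have hr : r ∈ Finset.Icc 1 k := by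
        rw [Finset.mem_Icc] at hp ⊢
        omega
      rw [hσ'end r hr]
      exact hP₁mem r hr
  have hjseq : ∀ p ≤ m + 1, jseq σ' p = jseq σ p := by
    intro p hp
    rcases Nat.eq_zero_or_pos p with rfl | h0
    · rfl
    · rw [jseq, jseq, if_neg h0.ne', if_neg h0.ne']
      rcases hp.lt_or_eq with h | rfl
      · exact hσ'rest p (Finset.mem_Icc.2 ⟨h0, by omega⟩)
      · have h1 : 1 ∈ Finset.Icc 1 k := Finset.mem_Icc.2 ⟨le_rfl, hk1⟩
        rw [hσ'end 1 h1, hend 1 h1, hstart]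
  rw [totalT_eq_add_vB m k hk1 d pre σ' P₁ hmem' hσ'end,
    totalT_eq_add_vB m k hk1 d pre σ P₂ hmem hend]
  refine add_lt_add_of_le_of_lt (Finset.sum_congr rfl fun q hq => ?_).le hv
  rw [Finset.mem_Icc] at hq
  have himage : (Finset.Icc q m).image σ' = (Finset.Icc q m).image σ :=
    Finset.image_congr fun r hr =>
      hσ'rest r (Finset.Icc_subset_Icc_left hq.1 (Finset.mem_coe.1 hr))
  rw [himage, hconfig, hjseq q hq.2, hjseq (q - 1) (by omega)]
end

section
/- (Return-path lower bound) Let P = (i_1,…,i_k) be a return path with k vertices (1 ≤ k ≤ n). Then every repair sequence σ that ends with P has total service disruption time T(σ) ≥ ∑_{p=1}^{n−k+1} (n+1−p) · s_p + v^B(P). -/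
/-- The multiset of all arc lengths `d(i,j)` over ordered pairs of distinct vertices of `V`. -/
def arcLengths (n : ℕ) (d : ℕ → ℕ → ℝ) : Multiset ℝ :=
  ((Finset.Icc 0 n ×ˢ Finset.Icc 0 n).filter fun x => x.1 ≠ x.2).val.map fun x => d x.1 x.2

/-- `sArc n d p` is the `p`-th smallest arc length (counted with multiplicity). -/
noncomputable def sArc (n : ℕ) (d : ℕ → ℕ → ℝ) (p : ℕ) : ℝ :=
  ((arcLengths n d).sort (· ≤ ·)).getD (p - 1) 0

/-- The `r` smallest entries of a sorted list sum to at most the sum of any sublist of length `r`. -/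
theorem List.Sublist.sum_range_getD_le_sum {l' l : List ℝ} (h : l'.Sublist l)
    (hl : l.Pairwise (· ≤ ·)) :
    ∑ i ∈ Finset.range l'.length, l.getD i 0 ≤ l'.sum := by
  obtain ⟨f, hf⟩ := List.sublist_iff_exists_orderEmbedding_getElem?_eq.1 h
  rw [← Fin.sum_univ_getElem, Finset.sum_range]
  refine Finset.sum_le_sum fun i _ => ?_
  have hi := hf i
  rw [List.getElem?_eq_getElem i.2] at hi
  obtain ⟨hlt, heq⟩ := List.getElem?_eq_some_iff.1 hi.symm
  have hle : (i : ℕ) ≤ f i := f.strictMono.id_le i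
  rw [List.getD_eq_getElem _ _ (hle.trans_lt hlt)]
  refine le_of_le_of_eq ?_ heq
  rcases hle.eq_or_lt with h | h
  · exact (getElem_congr_idx h).le
  · exact List.pairwise_iff_getElem.1 hl _ _ _ _ h

theorem Multiset.sum_range_getD_sort_le_sum {M A : Multiset ℝ} (h : M ≤ A) :
    ∑ i ∈ Finset.range M.card, (A.sort (· ≤ ·)).getD i 0 ≤ M.sum := by
  have hsub : (M.sort (· ≤ ·)).Sublist (A.sort (· ≤ ·)) := by
    refine List.sublist_of_subperm_of_pairwise ?_ (Multiset.pairwise_sort M (· ≤ ·))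
      (Multiset.pairwise_sort A (· ≤ ·))
    rw [← Multiset.coe_le, Multiset.sort_eq, Multiset.sort_eq]
    exact h
  have := hsub.sum_range_getD_le_sum (Multiset.pairwise_sort A (· ≤ ·))
  rwa [Multiset.length_sort, ← Multiset.sum_coe, Multiset.sort_eq] at this

/-- Nonnegative antitone weights preserve domination of all partial sums. -/
theorem Antitone.sum_range_mul_le_of_partial_sums {w : ℕ → ℝ} (hw : Antitone w) (hw0 : ∀ p, 0 ≤ w p)
    {s c : ℕ → ℝ} (m : ℕ)
    (h : ∀ r ≤ m, ∑ p ∈ Finset.range r, s p ≤ ∑ p ∈ Finset.range r, c p) :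
    ∑ p ∈ Finset.range m, w p * s p ≤ ∑ p ∈ Finset.range m, w p * c p := by
  have key : w m * (∑ p ∈ Finset.range m, c p - ∑ p ∈ Finset.range m, s p) ≤
      ∑ p ∈ Finset.range m, w p * c p - ∑ p ∈ Finset.range m, w p * s p := by
    induction m with
    | zero => simp
    | succ m ih =>
      have ih := ih fun r hr => h r (by omega)
      have hm := h m (by omega)
      have hm' := h (m + 1) le_rfl
      simp only [Finset.sum_range_succ] at hm' ⊢
      have h1 := mul_nonneg (sub_nonneg.2 (hw m.le_succ)) (sub_nonneg.2 hm')
      simp only [Nat.succ_eq_add_one] at h1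
      linarith
  linarith [mul_nonneg (hw0 m) (sub_nonneg.2 (h m le_rfl))]

theorem jseq_injOn {n : ℕ} {σ : ℕ → ℕ} (hσ : Set.BijOn σ (Set.Icc 1 n) (Set.Icc 1 n)) :
    Set.InjOn (jseq σ) (Set.Icc 0 n) := by
  intro a ha b hb hab
  simp only [Set.mem_Icc] at ha hb
  unfold jseq at hab
  split_ifs at hab with h1 h2 h2
  · omega
  · have := (hσ.mapsTo (Set.mem_Icc.2 ⟨Nat.pos_of_ne_zero h2, hb.2⟩)).1
    omega
  · have := (hσ.mapsTo (Set.mem_Icc.2 ⟨Nat.pos_of_ne_zero h1, ha.2⟩)).1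
    omega
  · exact hσ.injOn ⟨by omega, ha.2⟩ ⟨by omega, hb.2⟩ hab

theorem jseq_le {n : ℕ} {σ : ℕ → ℕ} (hσ : Set.BijOn σ (Set.Icc 1 n) (Set.Icc 1 n)) {p : ℕ}
    (hp : p ≤ n) : jseq σ p ≤ n := by
  unfold jseq
  split_ifs with h
  · omega
  · exact (hσ.mapsTo (Set.mem_Icc.2 ⟨Nat.pos_of_ne_zero h, hp⟩)).2

/-- The first `r` arcs of a tour are at least as long as the `r` shortest arcs together. -/
theorem sum_sArc_le_sum_tour {n : ℕ} {σ : ℕ → ℕ} (d : ℕ → ℕ → ℝ)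
    (hσ : Set.BijOn σ (Set.Icc 1 n) (Set.Icc 1 n)) {r : ℕ} (hr : r ≤ n) :
    ∑ p ∈ Finset.range r, sArc n d (p + 1) ≤
      ∑ p ∈ Finset.range r, d (jseq σ p) (jseq σ (p + 1)) := by
  have hinj := jseq_injOn hσ
  let e : ℕ → ℕ × ℕ := fun p => (jseq σ p, jseq σ (p + 1))
  have he : Set.InjOn e (Finset.range r) := by
    intro a ha b hb hab
    simp only [Finset.coe_range, Set.mem_Iio] at ha hb
    exact hinj ⟨by omega, by omega⟩ ⟨by omega, by omega⟩ (congrArg Prod.fst hab)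
  have hle : (Finset.range r).val.map (fun p => d (jseq σ p) (jseq σ (p + 1))) ≤
      arcLengths n d := by
    have hsub : (Finset.range r).image e ⊆
        (Finset.Icc 0 n ×ˢ Finset.Icc 0 n).filter fun x => x.1 ≠ x.2 := by
      intro x hx
      obtain ⟨p, hp, rfl⟩ := Finset.mem_image.1 hx
      have hp := Finset.mem_range.1 hp
      simp only [e, Finset.mem_filter, Finset.mem_product, Finset.mem_Icc]
      refine ⟨⟨⟨by omega, jseq_le hσ (by omega)⟩, by omega, jseq_le hσ (by omega)⟩, fun h => ?_⟩
      have := hinj ⟨by omega, by omega⟩ ⟨by omega, by omega⟩ h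
      omega
    have := Multiset.map_le_map (f := fun x : ℕ × ℕ => d x.1 x.2) (Finset.val_le_iff.2 hsub)
    rw [Finset.image_val_of_injOn he, Multiset.map_map] at this
    exact this
  have := Multiset.sum_range_getD_sort_le_sum hle
  rw [Multiset.card_map, Finset.card_val, Finset.card_range] at this
  exact this

theorem le_lastPos {n : ℕ} {pre : ℕ → ℕ → Prop} {σ : ℕ → ℕ} {p i : ℕ}
    (hp : p ∈ Finset.Icc 1 n) (h : pre (σ p) i) : p ≤ lastPos n pre σ i :=
  le_csSup ⟨n, fun _ hx => (Finset.mem_Icc.1 hx.1).2⟩ ⟨hp, h⟩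

/-- The total disruption time weights every arc of the tour by the number of vertices that are
without service while it is traversed. -/
theorem totalT_eq_sum_card_mul (n : ℕ) (d : ℕ → ℕ → ℝ) (pre : ℕ → ℕ → Prop) (σ : ℕ → ℕ) :
    totalT n d pre σ = ∑ q ∈ Finset.Icc 1 n,
      ((Finset.Icc 1 n).filter fun i => q ≤ lastPos n pre σ i).card *
        d (jseq σ (q - 1)) (jseq σ q) := by
  unfold totalT arrival
  have h : ∀ i ∈ Finset.Icc 1 n,
      ∑ q ∈ Finset.Icc 1 (lastPos n pre σ i), d (jseq σ (q - 1)) (jseq σ q) =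
        ∑ q ∈ Finset.Icc 1 n,
          if q ≤ lastPos n pre σ i then d (jseq σ (q - 1)) (jseq σ q) else 0 := by
    intro i _
    rw [← Finset.sum_filter]
    refine Finset.sum_congr ?_ fun _ _ => rfl
    ext q
    have := lastPos_le n pre σ i
    simp only [Finset.mem_Icc, Finset.mem_filter]
    omega
  rw [Finset.sum_congr rfl h, Finset.sum_comm]
  refine Finset.sum_congr rfl fun q _ => ?_
  rw [← Finset.sum_filter, Finset.sum_const, nsmul_eq_mul]

theorem le_card_filter_le_lastPos {n : ℕ} {pre : ℕ → ℕ → Prop} {σ : ℕ → ℕ}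
    (hrefl : ∀ i ∈ Finset.Icc 1 n, pre i i) (hσ : Set.BijOn σ (Set.Icc 1 n) (Set.Icc 1 n))
    {q : ℕ} (hq : 1 ≤ q) :
    n + 1 - q ≤ ((Finset.Icc 1 n).filter fun i => q ≤ lastPos n pre σ i).card := by
  rw [← Nat.card_Icc, ← Finset.card_image_of_injOn (s := Finset.Icc q n) (f := σ)]
  · refine Finset.card_le_card fun x hx => ?_
    obtain ⟨p, hp, rfl⟩ := Finset.mem_image.1 hx
    rw [Finset.mem_Icc] at hp
    have hp' : p ∈ Set.Icc 1 n := ⟨hq.trans hp.1, hp.2⟩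
    have hmem : σ p ∈ Finset.Icc 1 n := Finset.mem_Icc.2 (hσ.mapsTo hp')
    exact Finset.mem_filter.2
      ⟨hmem, hp.1.trans (le_lastPos (Finset.mem_Icc.2 hp') (hrefl _ hmem))⟩
  · refine hσ.injOn.mono fun p hp => ?_
    have := Finset.mem_Icc.1 (Finset.mem_coe.1 hp)
    exact ⟨hq.trans this.1, this.2⟩

theorem W_le_card_filter_le_lastPos {n : ℕ} {pre : ℕ → ℕ → Prop} {σ P : ℕ → ℕ} {k q : ℕ}
    (hk : k ≤ n) (hq : 1 ≤ q) (hend : ∀ q ∈ Finset.Icc 1 k, σ (n - k + q) = P q) :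
    W n pre (Finset.Icc 1 n \ (Finset.Icc q k).image P) ≤
      ((Finset.Icc 1 n).filter fun i => n - k + q ≤ lastPos n pre σ i).card := by
  rw [← Set.ncard_coe_finset]
  refine Set.ncard_le_ncard ?_ (Finset.finite_toSet _)
  rintro j ⟨hj, i, hi, hij, hnot⟩
  have hmem : i ∈ (Finset.Icc q k).image P := by
    by_contra h
    exact hnot (Finset.mem_sdiff.2 ⟨hi, h⟩)
  obtain ⟨p, hp, rfl⟩ := Finset.mem_image.1 hmem
  rw [Finset.mem_Icc] at hp
  rw [← hend p (Finset.mem_Icc.2 ⟨by omega, hp.2⟩)] at hij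
  have := le_lastPos (n := n) (Finset.mem_Icc.2 ⟨by omega, by omega⟩) hij
  exact Finset.mem_coe.2 (Finset.mem_filter.2 ⟨hj, by omega⟩)

theorem sum_Icc_one_eq_sum_range (f : ℕ → ℝ) (m : ℕ) :
    ∑ p ∈ Finset.Icc 1 m, f p = ∑ p ∈ Finset.range m, f (p + 1) := by
  induction m with
  | zero => simp
  | succ m ih => rw [Finset.sum_Icc_succ_top (by omega), ih, Finset.sum_range_succ]

/-- **Return-path lower bound.** For a return path `P` with `k` vertices,
every repair sequence `σ` ending with `P` satisfies
`T(σ) ≥ ∑_{p=1}^{n−k+1} (n+1−p) · s_p + v^B(P)`. -/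
theorem stmt12
    (n : ℕ) (hn : 1 ≤ n)
    (d : ℕ → ℕ → ℝ) (hd : ∀ i j, 0 ≤ d i j)
    (pre : ℕ → ℕ → Prop)
    (hrefl : ∀ i ∈ Finset.Icc 1 n, pre i i)
    (htrans : ∀ i j k, pre i j → pre j k → pre i k)
    (hantisymm : ∀ i j, pre i j → pre j i → i = j)
    (σ : ℕ → ℕ) (hσ : Set.BijOn σ (Set.Icc 1 n) (Set.Icc 1 n))
    (k : ℕ) (hk1 : 1 ≤ k) (hk2 : k ≤ n)
    (P : ℕ → ℕ)
    (hPinj : Set.InjOn P (Set.Icc 1 k)) (hPmem : ∀ q ∈ Finset.Icc 1 k, P q ∈ Finset.Icc 1 n)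
    (hend : ∀ q ∈ Finset.Icc 1 k, σ (n - k + q) = P q) :
    (∑ p ∈ Finset.Icc 1 (n - k + 1), ((n + 1 - p : ℕ) : ℝ) * sArc n d p) + vB n d pre k P
      ≤ totalT n d pre σ := by
  set c : ℕ → ℝ := fun q => d (jseq σ (q - 1)) (jseq σ q) with hc
  set w : ℕ → ℝ := fun q => ((Finset.Icc 1 n).filter fun i => q ≤ lastPos n pre σ i).card
  have hsplit : totalT n d pre σ =
      ∑ q ∈ Finset.Icc 1 (n - k + 1), w q * c q +
        ∑ q ∈ Finset.Icc 2 k, w (n - k + q) * c (n - k + q) := by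
    have hshift : ∑ q ∈ Finset.Icc 2 k, w (n - k + q) * c (n - k + q) =
        ∑ q ∈ Finset.Ioc (n - k + 1) n, w q * c q := by
      refine Finset.sum_bij (fun q _ => n - k + q) ?_ ?_ ?_ ?_
      · intro q hq
        simp only [Finset.mem_Icc, Finset.mem_Ioc] at *
        omega
      · intros
        omega
      · intro q hq
        simp only [Finset.mem_Icc, Finset.mem_Ioc] at *
        exact ⟨q - (n - k), by omega, by omega⟩
      · intros
        rfl
    rw [hshift, totalT_eq_sum_card_mul, ← Finset.sum_union]
    · refine Finset.sum_congr ?_ fun _ _ => rfl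
      ext q
      simp only [Finset.mem_Icc, Finset.mem_Ioc, Finset.mem_union]
      omega
    · refine Finset.disjoint_left.2 fun q => ?_
      simp only [Finset.mem_Icc, Finset.mem_Ioc]
      omega
  rw [hsplit]
  refine add_le_add ?_ ?_
  · have hlower : ∑ p ∈ Finset.Icc 1 (n - k + 1), ((n + 1 - p : ℕ) : ℝ) * sArc n d p ≤
        ∑ p ∈ Finset.Icc 1 (n - k + 1), ((n + 1 - p : ℕ) : ℝ) * c p := by
      rw [sum_Icc_one_eq_sum_range, sum_Icc_one_eq_sum_range]
      refine Antitone.sum_range_mul_le_of_partial_sums (w := fun p => ((n + 1 - (p + 1) : ℕ) : ℝ))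
        ?_ (fun _ => Nat.cast_nonneg _) _ fun r hr => ?_
      · intro a b hab
        exact Nat.cast_le.2 (by omega)
      · exact sum_sArc_le_sum_tour d hσ (by omega)
    refine hlower.trans (Finset.sum_le_sum fun q hq => ?_)
    exact mul_le_mul_of_nonneg_right
      (Nat.cast_le.2 (le_card_filter_le_lastPos hrefl hσ (Finset.mem_Icc.1 hq).1)) (hd _ _)
  · refine Finset.sum_le_sum fun q hq => ?_
    rw [Finset.mem_Icc] at hq
    have hcq : c (n - k + q) = d (P (q - 1)) (P q) := by
      have h1 := hend (q - 1) (Finset.mem_Icc.2 ⟨by omega, by omega⟩)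
      have h2 := hend q (Finset.mem_Icc.2 ⟨by omega, by omega⟩)
      rw [show n - k + (q - 1) = n - k + q - 1 by omega] at h1
      simp only [hc, jseq]
      rw [if_neg (by omega), if_neg (by omega), h1, h2]
    rw [hcq]
    exact mul_le_mul_of_nonneg_right
      (Nat.cast_le.2 (W_le_card_filter_le_lastPos hk2 (by omega) hend)) (hd _ _)
end

section
/- (Forward Bellman equation) For every subset X with {0} ⊊ X ⊆ V and every i ∈ X ∖ {0}, the forward value function satisfies u(X, i) = min over admissible j of [ u(X ∖ {i}, j) + W((X ∖ {i}) ∩ V_c) · d(j, i) ], where the minimum is over j ∈ (X ∖ {i}) ∖ {0} if X ∖ {i} ≠ {0}, and over j = 0 if X ∖ {i} = {0}. -/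
/-- Forward value function `u(X, i)`: the minimum over all orderings `(y_1,…,y_m)` of
`X ∖ {0}` ending at `y_m = i` (with `m = |X| − 1` and `y_0 = 0`) of
`∑_{p=1}^{m} W({y_1,…,y_{p−1}}) · d(y_{p−1}, y_p)`; in particular `u({0}, 0) = 0`. -/
noncomputable def uval (n : ℕ) (d : ℕ → ℕ → ℝ) (pre : ℕ → ℕ → Prop) (X : Finset ℕ) (i : ℕ) : ℝ :=
  sInf { c : ℝ | ∃ y : ℕ → ℕ, Set.BijOn y (Set.Icc 1 (X.card - 1)) ↑(X.erase 0) ∧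
    y (X.card - 1) = i ∧
    c = ∑ p ∈ Finset.Icc 1 (X.card - 1),
      (W n pre ((Finset.Icc 1 (p - 1)).image y) : ℝ) * d (jseq y (p - 1)) (jseq y p) }

/-- The cost of traversing the first `m` vertices of the ordering `y`, starting at the depot. -/
noncomputable def orderingCost (n : ℕ) (d : ℕ → ℕ → ℝ) (pre : ℕ → ℕ → Prop) (m : ℕ)
    (y : ℕ → ℕ) : ℝ :=
  ∑ p ∈ Finset.Icc 1 m,
    (W n pre ((Finset.Icc 1 (p - 1)).image y) : ℝ) * d (jseq y (p - 1)) (jseq y p)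

/-- `y` enumerates `X ∖ {0}` and ends at `i`. -/
def IsOrdering (X : Finset ℕ) (i : ℕ) (y : ℕ → ℕ) : Prop :=
  Set.BijOn y (Set.Icc 1 (X.card - 1)) ↑(X.erase 0) ∧ y (X.card - 1) = i

/-- The possible end vertices of an ordering of `X`. -/
def IsEndpoint (X : Finset ℕ) (j : ℕ) : Prop :=
  (X = {0} ∧ j = 0) ∨ (X ≠ {0} ∧ j ∈ X.erase 0)

theorem uval_eq_sInf (n : ℕ) (d : ℕ → ℕ → ℝ) (pre : ℕ → ℕ → Prop) (X : Finset ℕ) (i : ℕ) :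
    uval n d pre X i =
      sInf {c | ∃ y, IsOrdering X i y ∧ c = orderingCost n d pre (X.card - 1) y} := by
  simp only [uval, IsOrdering, orderingCost, and_assoc]

theorem orderingCost_nonneg (n : ℕ) {d : ℕ → ℕ → ℝ} (hd : ∀ i j, 0 ≤ d i j)
    (pre : ℕ → ℕ → Prop) (m : ℕ) (y : ℕ → ℕ) : 0 ≤ orderingCost n d pre m y :=
  Finset.sum_nonneg fun _ _ => mul_nonneg (Nat.cast_nonneg _) (hd _ _)

theorem orderingCost_succ (n : ℕ) (d : ℕ → ℕ → ℝ) (pre : ℕ → ℕ → Prop) (m : ℕ) (y : ℕ → ℕ) :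
    orderingCost n d pre (m + 1) y = orderingCost n d pre m y +
      (W n pre ((Finset.Icc 1 m).image y) : ℝ) * d (jseq y m) (y (m + 1)) := by
  simp [orderingCost, Finset.sum_Icc_succ_top, jseq]

theorem orderingCost_congr (n : ℕ) (d : ℕ → ℕ → ℝ) (pre : ℕ → ℕ → Prop) {m : ℕ} {y z : ℕ → ℕ}
    (h : Set.EqOn y z (Set.Icc 1 m)) : orderingCost n d pre m y = orderingCost n d pre m z := by
  have hj : ∀ p ≤ m, jseq y p = jseq z p := fun p hp => by
    unfold jseq
    split_ifs with h0
    · rfl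
    · exact h ⟨Nat.one_le_iff_ne_zero.2 h0, hp⟩
  refine Finset.sum_congr rfl fun p hp => ?_
  rw [Finset.mem_Icc] at hp
  rw [hj p hp.2, hj (p - 1) (by omega), Finset.image_congr fun q hq => h ?_]
  rw [Finset.coe_Icc, Set.mem_Icc] at hq
  exact ⟨hq.1, by omega⟩

theorem uval_le (n : ℕ) {d : ℕ → ℕ → ℝ} (hd : ∀ i j, 0 ≤ d i j) (pre : ℕ → ℕ → Prop)
    {X : Finset ℕ} {i : ℕ} {y : ℕ → ℕ} (hy : IsOrdering X i y) :
    uval n d pre X i ≤ orderingCost n d pre (X.card - 1) y := by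
  rw [uval_eq_sInf]
  refine csInf_le ⟨0, ?_⟩ ⟨y, hy, rfl⟩
  rintro _ ⟨z, -, rfl⟩
  exact orderingCost_nonneg n hd pre _ z

theorem le_uval (n : ℕ) (d : ℕ → ℕ → ℝ) (pre : ℕ → ℕ → Prop) {X : Finset ℕ} {i : ℕ} {a : ℝ}
    (hne : ∃ y, IsOrdering X i y)
    (h : ∀ y, IsOrdering X i y → a ≤ orderingCost n d pre (X.card - 1) y) :
    a ≤ uval n d pre X i := by
  rw [uval_eq_sInf]
  obtain ⟨y, hy⟩ := hne
  refine le_csInf ⟨_, y, hy, rfl⟩ ?_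
  rintro _ ⟨z, hz, rfl⟩
  exact h z hz

theorem uval_nonneg (n : ℕ) {d : ℕ → ℕ → ℝ} (hd : ∀ i j, 0 ≤ d i j) (pre : ℕ → ℕ → Prop)
    (X : Finset ℕ) (i : ℕ) : 0 ≤ uval n d pre X i := by
  rw [uval_eq_sInf]
  refine Real.sInf_nonneg ?_
  rintro _ ⟨z, -, rfl⟩
  exact orderingCost_nonneg n hd pre _ z

theorem card_sub_one_eq_card_erase_sub_one_add_one {X : Finset ℕ} {i : ℕ} (hX0 : 0 ∈ X)
    (hi : i ∈ X) (hi0 : i ≠ 0) : X.card - 1 = (X.erase i).card - 1 + 1 := by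
  have h1 := Finset.card_erase_add_one hi
  have h2 : 0 < (X.erase i).card := Finset.card_pos.2 ⟨0, Finset.mem_erase.2 ⟨hi0.symm, hX0⟩⟩
  omega

theorem exists_isEndpoint {X : Finset ℕ} (hX0 : 0 ∈ X) : ∃ j, IsEndpoint X j := by
  by_cases h : X = {0}
  · exact ⟨0, Or.inl ⟨h, rfl⟩⟩
  · obtain ⟨j, hj, hj0⟩ := (Finset.nontrivial_iff_ne_singleton hX0).2 h |>.exists_ne 0
    exact ⟨j, Or.inr ⟨h, Finset.mem_erase.2 ⟨hj0, hj⟩⟩⟩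

theorem IsOrdering.image_eq {X : Finset ℕ} {i : ℕ} {y : ℕ → ℕ} (hy : IsOrdering X i y) :
    (Finset.Icc 1 (X.card - 1)).image y = X.erase 0 := by
  rw [← Finset.coe_inj, Finset.coe_image, Finset.coe_Icc, hy.1.image_eq]

theorem IsOrdering.jseq_eq {X : Finset ℕ} {j : ℕ} {y : ℕ → ℕ} (hX0 : 0 ∈ X)
    (hj : IsEndpoint X j) (hy : IsOrdering X j y) : jseq y (X.card - 1) = j := by
  unfold jseq
  split_ifs with h0
  · rcases hj with ⟨-, rfl⟩ | ⟨hne, -⟩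
    · rfl
    · have := Finset.one_lt_card_iff_nontrivial.2 ((Finset.nontrivial_iff_ne_singleton hX0).2 hne)
      omega
  · exact hy.2

/-- Appending `i` to an ordering of `X ∖ {i}` gives an ordering of `X`. -/
theorem IsOrdering.update {X : Finset ℕ} {i j : ℕ} {y : ℕ → ℕ} (hX0 : 0 ∈ X) (hi : i ∈ X)
    (hi0 : i ≠ 0) (hy : IsOrdering (X.erase i) j y) :
    IsOrdering X i (Function.update y (X.card - 1) i) := by
  have hc := card_sub_one_eq_card_erase_sub_one_add_one hX0 hi hi0
  have hX : X.erase 0 = insert i ((X.erase i).erase 0) := by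
    rw [Finset.erase_right_comm, Finset.insert_erase (Finset.mem_erase.2 ⟨hi0, hi⟩)]
  refine ⟨?_, Function.update_self ..⟩
  have hI : Set.Icc 1 (X.card - 1) = insert (X.card - 1) (Set.Icc 1 ((X.erase i).card - 1)) := by
    ext p
    simp only [Set.mem_Icc, Set.mem_insert_iff]
    omega
  have hb : Set.BijOn (Function.update y (X.card - 1) i) (Set.Icc 1 ((X.erase i).card - 1))
      ↑((X.erase i).erase 0) := by
    refine hy.1.congr fun p hp => (Function.update_of_ne ?_ _ _).symm
    have := hp.2
    omega
  rw [hI, hX, Finset.coe_insert]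
  simpa using hb.insert (a := X.card - 1) (by simp)

/-- Removing the last vertex `i` of an ordering of `X` gives an ordering of `X ∖ {i}`. -/
theorem IsOrdering.erase {X : Finset ℕ} {i : ℕ} {y : ℕ → ℕ} (hX0 : 0 ∈ X) (hi : i ∈ X)
    (hi0 : i ≠ 0) (hy : IsOrdering X i y) :
    IsOrdering (X.erase i) (jseq y ((X.erase i).card - 1)) (jseq y) := by
  have hc := card_sub_one_eq_card_erase_sub_one_add_one hX0 hi hi0
  refine ⟨?_, rfl⟩
  have hI : Set.Icc 1 ((X.erase i).card - 1) = Set.Icc 1 (X.card - 1) \ {X.card - 1} := by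
    ext p
    simp only [Set.mem_Icc, Set.mem_sdiff, Set.mem_singleton_iff]
    omega
  have hb := hy.1.sdiff_singleton (a := X.card - 1) ⟨by omega, le_rfl⟩
  rw [hy.2, ← hI, ← Finset.coe_erase, Finset.erase_right_comm] at hb
  exact hb.congr fun p hp => (if_neg (Nat.one_le_iff_ne_zero.1 hp.1)).symm

theorem IsOrdering.isEndpoint {X : Finset ℕ} {j : ℕ} {y : ℕ → ℕ} (hX0 : 0 ∈ X)
    (hy : IsOrdering X j (jseq y)) : IsEndpoint X j := by
  by_cases h : X = {0}
  · subst h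
    exact Or.inl ⟨rfl, by simpa [jseq] using hy.2.symm⟩
  · have := Finset.one_lt_card_iff_nontrivial.2 ((Finset.nontrivial_iff_ne_singleton hX0).2 h)
    refine Or.inr ⟨h, ?_⟩
    have hm := hy.1.mapsTo (x := X.card - 1) ⟨by omega, le_rfl⟩
    rw [hy.2] at hm
    exact hm

theorem exists_isOrdering {X : Finset ℕ} {i : ℕ} (hX0 : 0 ∈ X) (hi : IsEndpoint X i) :
    ∃ y, IsOrdering X i y := by
  induction X using Finset.strongInduction generalizing i with
  | H X ih =>
    rcases hi with ⟨rfl, rfl⟩ | ⟨-, hi⟩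
    · exact ⟨fun _ => 0, by simp [IsOrdering]⟩
    · obtain ⟨hi0, hi⟩ := Finset.mem_erase.1 hi
      have h0 : 0 ∈ X.erase i := Finset.mem_erase.2 ⟨hi0.symm, hX0⟩
      obtain ⟨j, hj⟩ := exists_isEndpoint h0
      obtain ⟨y, hy⟩ := ih _ (Finset.erase_ssubset hi) h0 hj
      exact ⟨_, hy.update hX0 hi hi0⟩

/-- **Forward Bellman equation.** For every `X` with `{0} ⊊ X ⊆ V` and
every `i ∈ X ∖ {0}`,
`u(X, i) = min_j [ u(X ∖ {i}, j) + W((X ∖ {i}) ∩ V_c) · d(j, i) ]`, where the minimum is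
over `j ∈ (X ∖ {i}) ∖ {0}` if `X ∖ {i} ≠ {0}`, and over `j = 0` if `X ∖ {i} = {0}`. -/
theorem stmt16
    (n : ℕ) (hn : 1 ≤ n)
    (d : ℕ → ℕ → ℝ) (hd : ∀ i j, 0 ≤ d i j)
    (pre : ℕ → ℕ → Prop)
    (hrefl : ∀ i ∈ Finset.Icc 1 n, pre i i)
    (htrans : ∀ i j k, pre i j → pre j k → pre i k)
    (hantisymm : ∀ i j, pre i j → pre j i → i = j)
    (X : Finset ℕ) (hX0 : 0 ∈ X) (hXV : X ⊆ Finset.Icc 0 n) (hXne : X ≠ {0})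
    (i : ℕ) (hi : i ∈ X) (hi0 : i ≠ 0) :
    uval n d pre X i
      = sInf { c : ℝ | ∃ j : ℕ,
          ((X.erase i = {0} ∧ j = 0) ∨ (X.erase i ≠ {0} ∧ j ∈ (X.erase i).erase 0)) ∧
          c = uval n d pre (X.erase i) j + (W n pre ((X.erase i).erase 0) : ℝ) * d j i } := by
  have hc := card_sub_one_eq_card_erase_sub_one_add_one hX0 hi hi0
  have h0 : 0 ∈ X.erase i := Finset.mem_erase.2 ⟨hi0.symm, hX0⟩
  apply le_antisymm
  · obtain ⟨j₀, hj₀⟩ := exists_isEndpoint h0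
    refine le_csInf ⟨_, j₀, hj₀, rfl⟩ ?_
    rintro _ ⟨j, hj, rfl⟩
    rw [← sub_le_iff_le_add]
    refine le_uval n d pre (exists_isOrdering h0 hj) fun y hy => ?_
    rw [sub_le_iff_le_add]
    have heq : Set.EqOn y (Function.update y (X.card - 1) i)
        (Set.Icc 1 ((X.erase i).card - 1)) := fun p hp =>
      (Function.update_of_ne (by have := hp.2; omega) _ _).symm
    refine (uval_le n hd pre (hy.update hX0 hi hi0)).trans_eq ?_
    have hlast : jseq (Function.update y (X.card - 1) i) ((X.erase i).card - 1) = j := by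
      rw [← hy.jseq_eq h0 hj]
      unfold jseq
      rw [Function.update_of_ne (by omega)]
    have himg : (Finset.Icc 1 ((X.erase i).card - 1)).image (Function.update y (X.card - 1) i) =
        (X.erase i).erase 0 := by
      rw [← hy.image_eq]
      exact Finset.image_congr fun p hp => (heq (by simpa using hp)).symm
    have hcost := orderingCost_succ n d pre ((X.erase i).card - 1)
      (Function.update y (X.card - 1) i)
    rwa [himg, hlast, ← hc, Function.update_self, ← orderingCost_congr n d pre heq] at hcost
  · refine le_uval n d pre (exists_isOrdering hX0 (Or.inr ⟨hXne, Finset.mem_erase.2 ⟨hi0, hi⟩⟩))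
      fun y hy => ?_
    have hy' := hy.erase hX0 hi hi0
    have heq : Set.EqOn y (jseq y) (Set.Icc 1 ((X.erase i).card - 1)) := fun p hp =>
      (if_neg (Nat.one_le_iff_ne_zero.1 hp.1)).symm
    have hle : uval n d pre (X.erase i) (jseq y ((X.erase i).card - 1)) +
        (W n pre ((X.erase i).erase 0) : ℝ) * d (jseq y ((X.erase i).card - 1)) i ≤
          orderingCost n d pre (X.card - 1) y := by
      have himg : (Finset.Icc 1 ((X.erase i).card - 1)).image y = (X.erase i).erase 0 := by
        rw [← hy'.image_eq]
        exact Finset.image_congr fun p hp => heq (by simpa using hp)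
      have hcost := orderingCost_succ n d pre ((X.erase i).card - 1) y
      rw [himg, ← hc, hy.2, orderingCost_congr n d pre heq] at hcost
      rw [hcost]
      gcongr
      exact uval_le n hd pre hy'
    refine le_trans (csInf_le ?_ ⟨_, hy'.isEndpoint h0, rfl⟩) hle
    refine ⟨0, ?_⟩
    rintro _ ⟨j, -, rfl⟩
    exact add_nonneg (uval_nonneg n hd pre _ j) (mul_nonneg (Nat.cast_nonneg _) (hd _ _))
end
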